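/- Let X be a real Banach algebra with identity satisfying the sequential condition (P), and let S be a nonempty, closed and convex subset of X. Let A, C : X → X and B : S → X be weakly sequentially continuous operators such that: (i) A and C are Lipschitz with constants a and c respectively; (ii) A x is invertible in X for every x ∈ X; (iii) B(S) is bounded, with β = sup{‖B y‖ : y ∈ S}; (iv) whenever x ∈ X satisfies x = A x · B y + C x for some y ∈ S, then x ∈ S; (v) the set {x ∈ X : there exists y ∈ S with x = A x · B y + C x} is relatively weakly compact. If β·a + c < 1, then there exists x ∈ S with x = A x · B x + C x. -/

import Mathlib

open Filter Topology Pointwise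

variable {X : Type*} [NormedAddCommGroup X] [NormedSpace ℝ X]

/-- `u` converges weakly to `x`. -/
def WeakConv (u : ℕ → X) (x : X) : Prop :=
  ∀ f : X →L[ℝ] ℝ, Tendsto (fun n => f (u n)) atTop (𝓝 (f x))

/-- A set is weakly compact if it is compact in the weak topology `σ(X, X*)`. -/
def WeaklyCompact (K : Set X) : Prop :=
  IsCompact (toWeakSpace ℝ X '' K)

/-- The closure of a set in the weak topology. -/
def weakClosure (S : Set X) : Set X :=
  toWeakSpace ℝ X ⁻¹' closure (toWeakSpace ℝ X '' S)

/-- A set is relatively weakly compact if its weak closure is weakly compact. -/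
def RelWeaklyCompact (S : Set X) : Prop :=
  WeaklyCompact (weakClosure S)

/-- The De Blasi measure of weak noncompactness. -/
noncomputable def deBlasi (S : Set X) : ℝ :=
  sInf {r : ℝ | 0 ≤ r ∧ ∃ K : Set X, WeaklyCompact K ∧ S ⊆ K + Metric.closedBall (0 : X) r}
/-- Condition (P): the product of weakly convergent sequences converges weakly to the
product of the limits. -/
def CondP (X : Type*) [NormedRing X] [NormedAlgebra ℝ X] : Prop :=
  ∀ (u v : ℕ → X) (x y : X), WeakConv u x → WeakConv v y →
    WeakConv (fun n => u n * v n) (x * y)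


section Scarf

variable {V I R : Type*} [LinearOrder R]

/-- A finite set `G` is dominant for the family of rankings `r` if no element is ranked strictly
above the minimum of `G` by all rankings simultaneously. -/
def ScarfDominant (r : I → V → R) (G : Finset V) : Prop :=
  ∀ x, ∃ i, ∀ y ∈ G, r i x ≤ r i y

theorem ScarfDominant.mono {r : I → V → R} {G H : Finset V} (hG : ScarfDominant r G)
    (h : H ⊆ G) : ScarfDominant r H := fun x =>
  let ⟨i, hi⟩ := hG x
  ⟨i, fun y hy => hi y (h hy)⟩

/-- `x` is the `r e`-largest point among those exceeding `μ i` in all rankings `i` but `e`, and it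
lies below `μ e` in the ranking `e`. -/
def ScarfPivot (r : I → V → R) (μ : I → V) (e : I) (x : V) : Prop :=
  r e x < r e (μ e) ∧ (∀ i ≠ e, r i (μ i) < r i x) ∧
    ∀ y, (∀ i ≠ e, r i (μ i) < r i y) → r e y ≤ r e x

theorem ScarfPivot.unique {r : I → V → R} (hr : ∀ i, Function.Injective (r i)) {μ : I → V} {e : I}
    {x y : V} (hx : ScarfPivot r μ e x) (hy : ScarfPivot r μ e y) : x = y :=
  hr e (le_antisymm (hy.2.2 x hx.2.1) (hx.2.2 y hy.2.1))

theorem ScarfPivot.dominant_insert [DecidableEq V] {r : I → V → R} {μ : I → V} {e : I} {x : V}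
    {D : Finset V}
    (hμ : ∀ i, ∀ y ∈ D, r i (μ i) ≤ r i y) (hx : ScarfPivot r μ e x) :
    x ∉ D ∧ ScarfDominant r (insert x D) := by
  refine ⟨fun h => absurd (hμ e x h) (not_le.2 hx.1), fun y => ?_⟩
  by_cases h : ∀ i ≠ e, r i (μ i) < r i y
  · refine ⟨e, fun z hz => (hx.2.2 y h).trans ?_⟩
    rcases Finset.mem_insert.1 hz with rfl | hz
    · exact le_rfl
    · exact hx.1.le.trans (hμ e z hz)
  · push Not at h
    obtain ⟨i, hi, hy⟩ := h
    refine ⟨i, fun z hz => hy.trans ?_⟩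
    rcases Finset.mem_insert.1 hz with rfl | hz
    · exact (hx.2.1 i hi).le
    · exact hμ i z hz

theorem ScarfPivot.exists_of_nonempty [Fintype V] {r : I → V → R} {μ : I → V} {e e' : I}
    {D : Finset V} (hr : ∀ i, Function.Injective (r i)) (hD : ScarfDominant r D)
    (hμD : ∀ i, μ i ∈ D) (hee : e' ≠ e) (hμee : μ e' = μ e)
    (hne : ∃ y, ∀ i ≠ e, r i (μ i) < r i y) : ∃ x, ScarfPivot r μ e x := by
  classical
  obtain ⟨x, hx, hmax⟩ := Finset.exists_max_image
    (Finset.univ.filter fun y => ∀ i ≠ e, r i (μ i) < r i y) (r e)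
    (by obtain ⟨y, hy⟩ := hne; exact ⟨y, by simpa using hy⟩)
  have hx' : ∀ i ≠ e, r i (μ i) < r i x := by simpa using hx
  refine ⟨x, ?_, hx', fun y hy => hmax y (by simpa using hy)⟩
  obtain ⟨i, hi⟩ := hD x
  have hie : i = e := by
    by_contra h
    exact absurd (hi _ (hμD i)) (not_le.2 (hx' i h))
  subst hie
  refine lt_of_le_of_ne (hi _ (hμD i)) fun h => ?_
  have hxe : x = μ i := hr i h
  have := hx' e' hee
  rw [hμee, hxe] at this
  exact lt_irrefl _ this

/-- A dominant set with one element less than the number of rankings, all of whose pivots are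
unobstructed, is contained in exactly two dominant sets with one more element. -/
theorem ScarfDominant.card_extensions [Fintype V] [DecidableEq V] [Fintype I] [DecidableEq I]
    {r : I → V → R} (hr : ∀ i, Function.Injective (r i))
    {D : Finset V} (hD : ScarfDominant r D) (hcard : D.card + 1 = Fintype.card I)
    (hDne : D.Nonempty)
    (hfree : ∀ μ : I → V, (∀ i, μ i ∈ D) → (∀ i, ∀ y ∈ D, r i (μ i) ≤ r i y) →
      ∀ e, ∃ y, ∀ i ≠ e, r i (μ i) < r i y)
    (s : Finset (Finset V))
    (hs : ∀ G, G ∈ s ↔ G.card = Fintype.card I ∧ ScarfDominant r G ∧ D ⊆ G) : s.card = 2 := by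
  choose μ hμD hμ using fun i => Finset.exists_min_image D (r i) hDne
  have hsurj : ∀ y ∈ D, ∀ i, (∀ z ∈ D, r i y ≤ r i z) → μ i = y := fun y hy i hi =>
    hr i (le_antisymm (hμ i y hy) (hi _ (hμD i)))
  obtain ⟨a, -, b, -, hab, hμab⟩ := Finset.exists_ne_map_eq_of_card_lt_of_maps_to
    (s := Finset.univ) (t := D) (f := μ) (by rw [Finset.card_univ]; omega) (fun i _ => hμD i)
  have inj : ∀ e e', e ≠ e' → μ e = μ e' → ∀ i j, i ≠ e → j ≠ e → μ i = μ j → i = j := by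
    intro e e' hee hμe i j hi hj hij
    have him : (Finset.univ.erase e).image μ = D := by
      ext y
      constructor
      · intro hy
        obtain ⟨i, -, rfl⟩ := Finset.mem_image.1 hy
        exact hμD i
      · intro hy
        obtain ⟨i, hi⟩ := hD y
        have := hsurj y hy i hi
        by_cases hie : i = e
        · exact Finset.mem_image.2 ⟨e', by simp [hee.symm], by rw [← hμe, ← hie, this]⟩
        · exact Finset.mem_image.2 ⟨i, by simp [hie], this⟩
    have hc : ((Finset.univ.erase e).image μ).card = (Finset.univ.erase e).card := by
      rw [him, Finset.card_erase_of_mem (Finset.mem_univ _), Finset.card_univ]; omega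
    exact Finset.card_image_iff.1 hc (by simp [hi]) (by simp [hj]) hij
  have key : ∀ e e', e ≠ e' → μ e = μ e' → ∀ x, x ∉ D → ScarfDominant r (insert x D) →
      r e x < r e (μ e) → ScarfPivot r μ e x := by
    intro e e' hee hμe x hxD hx hlt
    have hj : ∀ j ≠ e, r j (μ j) < r j x := by
      intro j hj
      obtain ⟨k, hk⟩ := hx (μ j)
      have hkj : μ k = μ j := hsurj _ (hμD j) k fun z hz => hk z (Finset.mem_insert_of_mem hz)
      have hkx := hk x (Finset.mem_insert_self _ _)
      have hke : k ≠ e := by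
        rintro rfl
        rw [← hkj] at hkx
        exact absurd hlt (not_lt.2 hkx)
      obtain rfl := inj e e' hee hμe k j hke hj hkj
      exact lt_of_le_of_ne hkx fun h => hxD (hr k h ▸ hμD k)
    refine ⟨hlt, hj, fun y hy => ?_⟩
    obtain ⟨i, hi⟩ := hx y
    by_cases hie : i = e
    · exact hie ▸ hi x (Finset.mem_insert_self _ _)
    · exact absurd (hi _ (Finset.mem_insert_of_mem (hμD i))) (not_le.2 (hy i hie))
  obtain ⟨x, hx⟩ := ScarfPivot.exists_of_nonempty hr hD hμD hab.symm hμab.symm (hfree μ hμD hμ a)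
  obtain ⟨y, hy⟩ := ScarfPivot.exists_of_nonempty hr hD hμD hab hμab (hfree μ hμD hμ b)
  obtain ⟨hxD, hxG⟩ := hx.dominant_insert hμ
  obtain ⟨hyD, hyG⟩ := hy.dominant_insert hμ
  have hxy : x ≠ y := by
    rintro rfl
    exact lt_asymm hx.1 (hy.2.1 a hab)
  have : s = {insert x D, insert y D} := by
    ext G
    rw [hs, Finset.mem_insert, Finset.mem_singleton]
    constructor
    · rintro ⟨hGc, hG, hDG⟩
      obtain ⟨z, hz⟩ : ∃ z, G \ D = {z} := Finset.card_eq_one.1 (by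
        rw [Finset.card_sdiff_of_subset hDG]; omega)
      have hzD : z ∉ D := (Finset.mem_sdiff.1 (hz ▸ Finset.mem_singleton_self z)).2
      have hGz : G = insert z D := by
        rw [Finset.insert_eq, ← hz, Finset.sdiff_union_of_subset hDG]
      subst hGz
      obtain ⟨i, hi⟩ := hG z
      have hlt : r i z < r i (μ i) :=
        lt_of_le_of_ne (hi _ (Finset.mem_insert_of_mem (hμD i))) fun h => hzD (hr i h ▸ hμD i)
      obtain ⟨j, hj⟩ := hG (μ i)
      have hji : μ j = μ i := hsurj _ (hμD i) j fun w hw => hj w (Finset.mem_insert_of_mem hw)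
      have hne : j ≠ i := by
        rintro rfl
        exact absurd hlt (not_lt.2 (hj z (Finset.mem_insert_self _ _)))
      have hi_ab : i = a ∨ i = b := by
        by_contra! h
        by_cases hja : j = a
        · exact hne (inj b a hab.symm hμab.symm j i (hja ▸ hab) h.2 hji)
        · exact hne (inj a b hab hμab j i hja h.1 hji)
      rcases hi_ab with rfl | rfl
      · exact Or.inl (by rw [(key i b hab hμab z hzD hG hlt).unique hr hx])
      · exact Or.inr (by rw [(key i a hab.symm hμab.symm z hzD hG hlt).unique hr hy])
    · rintro (rfl | rfl)
      · exact ⟨by rw [Finset.card_insert_of_notMem hxD, hcard], hxG, Finset.subset_insert _ _⟩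
      · exact ⟨by rw [Finset.card_insert_of_notMem hyD, hcard], hyG, Finset.subset_insert _ _⟩
  rw [this, Finset.card_pair]
  intro h
  have : x ∈ insert y D := h ▸ Finset.mem_insert_self x D
  rcases Finset.mem_insert.1 this with h | h
  exacts [hxy h, hxD h]

/-- A set with as many elements as there are colours which is not rainbow has an even number of
facets carrying all colours but `k`. -/
theorem even_card_colored_facets [DecidableEq V] [Fintype I] [DecidableEq I] {c : V → I} {k : I}
    {G : Finset V} (hG : G.card = Fintype.card I) (hGc : G.image c ≠ Finset.univ)
    (s : Finset (Finset V))
    (hs : ∀ D, D ∈ s ↔ D ⊆ G ∧ D.card + 1 = Fintype.card I ∧ D.image c = Finset.univ.erase k) :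
    Even s.card := by
  rcases s.eq_empty_or_nonempty with rfl | ⟨D, hD⟩
  · simp
  have herase : ∀ D ∈ s, ∃ v ∈ G, D = G.erase v := by
    intro D hD
    obtain ⟨hDG, hDc, -⟩ := (hs D).1 hD
    obtain ⟨v, hv⟩ : ∃ z, G \ D = {z} := Finset.card_eq_one.1 (by
      rw [Finset.card_sdiff_of_subset hDG]; omega)
    refine ⟨v, (Finset.mem_sdiff.1 (hv ▸ Finset.mem_singleton_self v)).1, ?_⟩
    rw [Finset.erase_eq, ← hv, Finset.sdiff_sdiff_eq_self hDG]
  have hinj : ∀ D ∈ s, Set.InjOn c D := by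
    intro D hD
    obtain ⟨-, hDc, hDi⟩ := (hs D).1 hD
    refine Finset.card_image_iff.1 ?_
    rw [hDi, Finset.card_erase_of_mem (Finset.mem_univ _), Finset.card_univ]; omega
  obtain ⟨v, hv, rfl⟩ := herase D hD
  have hDi := ((hs _).1 hD).2.2
  have hvk : c v ≠ k := by
    intro h
    apply hGc
    rw [← Finset.insert_erase hv, Finset.image_insert, hDi, h,
      Finset.insert_erase (Finset.mem_univ _)]
  obtain ⟨u, hu, huv⟩ : ∃ u ∈ G.erase v, c u = c v := Finset.mem_image.1 (by
    rw [hDi]; simp [hvk])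
  obtain ⟨huv', huG⟩ := Finset.mem_erase.1 hu
  have hDu : G.erase u ∈ s := by
    rw [hs]
    refine ⟨Finset.erase_subset _ _, by rw [Finset.card_erase_add_one huG, hG], ?_⟩
    rw [← hDi]
    ext i
    simp only [Finset.mem_image, Finset.mem_erase]
    constructor
    · rintro ⟨w, ⟨hwu, hw⟩, rfl⟩
      by_cases hwv : w = v
      · exact ⟨u, ⟨huv', huG⟩, by rw [huv, hwv]⟩
      · exact ⟨w, ⟨hwv, hw⟩, rfl⟩
    · rintro ⟨w, ⟨hwv, hw⟩, rfl⟩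
      by_cases hwu : w = u
      · exact ⟨v, ⟨huv'.symm, hv⟩, by rw [hwu, huv]⟩
      · exact ⟨w, ⟨hwu, hw⟩, rfl⟩
  have : s = {G.erase v, G.erase u} := by
    ext D'
    rw [Finset.mem_insert, Finset.mem_singleton]
    constructor
    · intro hD'
      obtain ⟨w, hw, rfl⟩ := herase D' hD'
      by_contra! h
      have hwv : v ≠ w := fun e => h.1 (by rw [e])
      have hwu : u ≠ w := fun e => h.2 (by rw [e])
      exact huv' (hinj _ hD' (by simp [hwu, huG]) (by simp [hwv, hv]) huv)
    · rintro (rfl | rfl) <;> assumption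
  rw [this, Finset.card_pair]
  · exact even_two
  · intro h
    have : u ∈ G.erase u := h ▸ hu
    simp at this

/-- **Scarf's lemma**: if each ranking `r i` has a least element `s i`, which every other ranking
places above all the ordinary elements, then any colouring in which `s i` has colour `i` admits a
dominant set containing each colour exactly once. -/
theorem exists_rainbow_scarfDominant [Fintype V] [DecidableEq V] [Fintype I] [DecidableEq I]
    [Nonempty I] (r : I → V → R)
    (hr : ∀ i, Function.Injective (r i)) (s : I → V) (hs : Function.Injective s)
    (hmin : ∀ i v, r i (s i) ≤ r i v)
    (hmax : ∀ i j, j ≠ i → ∀ v, v ∉ Set.range s → r i v < r i (s j))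
    (c : V → I) (hc : ∀ i, c (s i) = i) :
    ∃ G : Finset V, ScarfDominant r G ∧ G.image c = Finset.univ := by
  classical
  obtain ⟨k⟩ := ‹Nonempty I›
  by_contra! hno
  let rooms : Finset (Finset V) :=
    Finset.univ.filter fun G => G.card = Fintype.card I ∧ ScarfDominant r G
  let doors : Finset (Finset V) := Finset.univ.filter fun D =>
    D.card + 1 = Fintype.card I ∧ ScarfDominant r D ∧ D.image c = Finset.univ.erase k
  have hcount := Finset.sum_card_bipartiteAbove_eq_sum_card_bipartiteBelow
    (s := doors) (t := rooms) (fun D G => D ⊆ G)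
  have hrooms : Even (∑ G ∈ rooms, (doors.bipartiteBelow (fun D G => D ⊆ G) G).card) := by
    refine Finset.even_sum _ fun G hG => ?_
    obtain ⟨hGc, hGd⟩ := (Finset.mem_filter.1 hG).2
    refine even_card_colored_facets hGc (hno G hGd) (k := k) _ fun D => ?_
    simp only [Finset.bipartiteBelow, doors, Finset.mem_filter, Finset.mem_univ, true_and]
    exact ⟨fun h => ⟨h.2, h.1.1, h.1.2.2⟩, fun h => ⟨⟨h.2.1, hGd.mono h.1, h.2.2⟩, h.1⟩⟩
  set D₀ : Finset V := (Finset.univ.erase k).image s with hD₀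
  have hD₀card : D₀.card + 1 = Fintype.card I := by
    rw [hD₀, Finset.card_image_of_injective _ hs, Finset.card_erase_add_one (Finset.mem_univ _),
      Finset.card_univ]
  have hmemD₀ : ∀ i ≠ k, s i ∈ D₀ := fun i hi => Finset.mem_image.2 ⟨i, by simp [hi], rfl⟩
  have hskD₀ : s k ∉ D₀ := by
    intro h
    obtain ⟨i, hi, hik⟩ := Finset.mem_image.1 h
    exact (Finset.mem_erase.1 hi).1 (hs hik)
  obtain ⟨x, hx, hxmax⟩ := Finset.exists_max_image (D₀ᶜ) (r k) ⟨s k, by simpa using hskD₀⟩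
  have hxD₀ : x ∉ D₀ := by simpa using hx
  have hdomx : ScarfDominant r (insert x D₀) := by
    intro y
    by_cases hy : y ∈ D₀
    · obtain ⟨i, -, rfl⟩ := Finset.mem_image.1 hy
      exact ⟨i, fun z _ => hmin i z⟩
    · refine ⟨k, fun z hz => ?_⟩
      rcases Finset.mem_insert.1 hz with rfl | hz
      · exact hxmax y (by simpa using hy)
      · obtain ⟨j, hj, rfl⟩ := Finset.mem_image.1 hz
        by_cases hyk : y = s k
        · exact hyk ▸ hmin k _
        · refine (hmax k j (Finset.mem_erase.1 hj).1 y ?_).le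
          rintro ⟨i, rfl⟩
          by_cases hik : i = k
          · exact hyk (by rw [hik])
          · exact hy (hmemD₀ i hik)
  have hD₀door : D₀ ∈ doors := by
    refine Finset.mem_filter.2 ⟨Finset.mem_univ _, hD₀card,
      hdomx.mono (Finset.subset_insert _ _), ?_⟩
    rw [hD₀, Finset.image_image, show c ∘ s = id from funext hc, Finset.image_id]
  have hone : (rooms.bipartiteAbove (fun D G => D ⊆ G) D₀).card = 1 := by
    refine Finset.card_eq_one.2 ⟨insert x D₀, ?_⟩
    ext G
    simp only [Finset.bipartiteAbove, rooms, Finset.mem_filter, Finset.mem_univ, true_and,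
      Finset.mem_singleton]
    constructor
    · rintro ⟨⟨hGc, hG⟩, hDG⟩
      obtain ⟨z, hz⟩ : ∃ z, G \ D₀ = {z} := Finset.card_eq_one.1 (by
        rw [Finset.card_sdiff_of_subset hDG]; omega)
      have hzD : z ∉ D₀ := (Finset.mem_sdiff.1 (hz ▸ Finset.mem_singleton_self z)).2
      have hGz : G = insert z D₀ := by
        rw [Finset.insert_eq, ← hz, Finset.sdiff_union_of_subset hDG]
      subst hGz
      obtain ⟨i, hi⟩ := hG x
      have hik : i = k := by
        by_contra hik
        have h1 := hi (s i) (Finset.mem_insert_of_mem (hmemD₀ i hik))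
        exact hxD₀ (hr i (le_antisymm h1 (hmin i x)) ▸ hmemD₀ i hik)
      subst hik
      rw [hr i (le_antisymm (hi z (Finset.mem_insert_self _ _)) (hxmax z (by simpa using hzD)))]
    · rintro rfl
      exact ⟨⟨by rw [Finset.card_insert_of_notMem hxD₀, hD₀card], hdomx⟩,
        Finset.subset_insert _ _⟩
  have htwo : ∀ D ∈ doors.erase D₀, (rooms.bipartiteAbove (fun D G => D ⊆ G) D).card = 2 := by
    intro D hD
    obtain ⟨hne, hD⟩ := Finset.mem_erase.1 hD
    obtain ⟨hDc, hDd, hDi⟩ := (Finset.mem_filter.1 hD).2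
    refine hDd.card_extensions hr hDc ?_ ?_ _ fun G => by
      simp [Finset.bipartiteAbove, rooms, and_assoc]
    · rw [Finset.nonempty_iff_ne_empty]
      rintro rfl
      exact hne (Finset.card_eq_zero.1 (by simpa using hDc.trans hD₀card.symm)).symm
    · intro μ hμD hμ e
      refine ⟨s e, fun i hie => ?_⟩
      by_contra! hle
      have hsub : D ⊆ (Finset.univ.erase i).image s := by
        intro y hy
        have hey := hle.trans (hμ i y hy)
        by_cases hys : y ∈ Set.range s
        · obtain ⟨j, rfl⟩ := hys
          refine Finset.mem_image.2 ⟨j, ?_, rfl⟩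
          refine Finset.mem_erase.2 ⟨?_, Finset.mem_univ _⟩
          rintro rfl
          exact hie (hs (hr j (le_antisymm (hmin j _) hey)))
        · exact absurd (hmax i e hie.symm y hys) (not_lt.2 hey)
      have hDeq : D = (Finset.univ.erase i).image s := by
        refine Finset.eq_of_subset_of_card_le hsub ?_
        rw [Finset.card_image_of_injective _ hs, Finset.card_erase_of_mem (Finset.mem_univ _),
          Finset.card_univ]
        omega
      rw [hDeq, Finset.image_image, show c ∘ s = id from funext hc, Finset.image_id] at hDi
      have hik : i = k := by
        by_contra h
        have : k ∈ Finset.univ.erase i := by simp [Ne.symm h]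
        rw [hDi] at this
        simp at this
      exact hne (by rw [hDeq, hik])
  rw [← hcount, ← Finset.add_sum_erase _ _ hD₀door, hone, Finset.sum_congr rfl htwo,
    Finset.sum_const, smul_eq_mul] at hrooms
  obtain ⟨m, hm⟩ := hrooms
  omega

end Scarf

section Brouwer

/-- The points of the standard simplex whose coordinates are multiples of `1 / k`. -/
abbrev SimplexGrid (I : Type*) [Fintype I] (k : ℕ) : Type _ :=
  {v : I → Fin (k + 1) // ∑ i, (v i : ℕ) = k}

variable {I : Type*} [Fintype I]

/-- A point of the grid as a point of the standard simplex. -/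
noncomputable def SimplexGrid.toReal {k : ℕ} (v : SimplexGrid I k) : I → ℝ :=
  fun i => ((v.1 i : ℕ) : ℝ) / k

theorem SimplexGrid.toReal_mem {k : ℕ} (hk : 0 < k) (v : SimplexGrid I k) :
    v.toReal ∈ stdSimplex ℝ I := by
  refine ⟨fun i => by unfold SimplexGrid.toReal; positivity, ?_⟩
  have h : ((∑ i, (v.1 i : ℕ) : ℕ) : ℝ) = k := by rw [v.2]
  push_cast at h
  have hk' : (k : ℝ) ≠ 0 := by positivity
  simp only [SimplexGrid.toReal]
  rw [← Finset.sum_div, h, div_self hk']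

theorem SimplexGrid.exists_of_sum_le {k : ℕ} {C : Finset I} (hC : C.Nonempty) {w : I → ℕ}
    (hw : ∑ i ∈ C, w i ≤ k) : ∃ x : SimplexGrid I k, ∀ i ∈ C, w i ≤ x.1 i := by
  classical
  obtain ⟨i₁, hi₁⟩ := hC
  let u : I → ℕ := fun i => (if i ∈ C then w i else 0) + if i = i₁ then k - ∑ i ∈ C, w i else 0
  have hu : ∑ i, u i = k := by
    simp only [u, Finset.sum_add_distrib, Finset.sum_ite_mem, Finset.univ_inter,
      Finset.sum_ite_eq', Finset.mem_univ, if_true]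
    omega
  have hle : ∀ i, u i < k + 1 := fun i =>
    Nat.lt_succ_of_le (hu ▸ Finset.single_le_sum (f := u) (fun _ _ => Nat.zero_le _)
      (Finset.mem_univ i))
  refine ⟨⟨fun i => ⟨u i, hle i⟩, hu⟩, fun i hi => ?_⟩
  simp [u, hi]

/-- A combinatorial form of Brouwer's theorem, on a grid in the simplex. -/
theorem exists_grid_cell [Nonempty I] {k : ℕ} (c : SimplexGrid I k → I) :
    ∃ (S : Finset (SimplexGrid I k)) (C : Finset I), S.Nonempty ∧
      (∀ i ∈ C, ∃ g ∈ S, c g = i) ∧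
      (∀ u ∈ S, ∀ v ∈ S, ∀ i, (u.1 i : ℕ) ≤ v.1 i + Fintype.card I) ∧
      ∀ v ∈ S, ∀ i ∉ C, (v.1 i : ℕ) ≤ Fintype.card I := by
  classical
  let h : I → SimplexGrid I k ⊕ I → ℕ := fun i =>
    Sum.elim (fun v => (v.1 i : ℕ) + 1) fun j => if j = i then 0 else k + 2
  let r : I → SimplexGrid I k ⊕ I → ℕ ×ₗ ℕ := fun i x =>
    toLex (h i x, (Fintype.equivFin (SimplexGrid I k ⊕ I) x : ℕ))
  have hr : ∀ i, Function.Injective (r i) := fun i x y hxy => by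
    have : ((Fintype.equivFin (SimplexGrid I k ⊕ I) x : ℕ)) =
      (Fintype.equivFin (SimplexGrid I k ⊕ I) y : ℕ) := congrArg (fun z => (ofLex z).2) hxy
    exact (Fintype.equivFin _).injective (Fin.ext this)
  have hlt : ∀ i x y, h i x < h i y → r i x < r i y := fun i x y hxy =>
    Prod.Lex.toLex_lt_toLex.2 (Or.inl hxy)
  have hle : ∀ i x y, r i x ≤ r i y → h i x ≤ h i y := fun i x y hxy =>
    not_lt.1 fun hc => absurd (hlt i y x hc) (not_lt.2 hxy)
  obtain ⟨G, hG, hGc⟩ := exists_rainbow_scarfDominant r hr Sum.inr Sum.inr_injective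
    (by
      intro i v
      by_cases hv : v = Sum.inr i
      · rw [hv]
      · refine (hlt i _ _ ?_).le
        rcases v with v | j
        · simp [h]
        · have : j ≠ i := fun e => hv (by rw [e])
          simp [h, this])
    (by
      rintro i j hji (v | l) hv
      · have := (v.1 i).2
        exact hlt i _ _ (by simpa [h, hji] using this)
      · exact absurd ⟨l, rfl⟩ hv)
    (Sum.elim c id) (fun _ => rfl)
  let S : Finset (SimplexGrid I k) := Finset.univ.filter fun v => Sum.inl v ∈ G
  let C : Finset I := Finset.univ.filter fun i => Sum.inr i ∉ G
  have hdom : ∀ x : SimplexGrid I k, ∃ i ∈ C, ∀ v ∈ S, (x.1 i : ℕ) ≤ v.1 i := by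
    intro x
    obtain ⟨i, hi⟩ := hG (Sum.inl x)
    refine ⟨i, Finset.mem_filter.2 ⟨Finset.mem_univ _, fun hmem => ?_⟩, fun v hv => ?_⟩
    · have := hle _ _ _ (hi _ hmem)
      simp [h] at this
    · have := hle _ _ _ (hi _ (Finset.mem_filter.1 hv).2)
      simpa [h] using this
  have hcol : ∀ i ∈ C, ∃ g ∈ S, c g = i := by
    intro i hi
    obtain ⟨g, hg, hgi⟩ := Finset.mem_image.1 (hGc.symm ▸ Finset.mem_univ i)
    rcases g with g | j
    · exact ⟨g, Finset.mem_filter.2 ⟨Finset.mem_univ _, hg⟩, hgi⟩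
    · obtain rfl : j = i := hgi
      exact absurd hg (Finset.mem_filter.1 hi).2
  have hCne : C.Nonempty := by
    obtain ⟨x, -⟩ := SimplexGrid.exists_of_sum_le (k := k) (C := (Finset.univ : Finset I))
      Finset.univ_nonempty (w := 0) (by simp)
    obtain ⟨i, hi, -⟩ := hdom x
    exact ⟨i, hi⟩
  have hSne : S.Nonempty := by
    obtain ⟨i, hi⟩ := hCne
    obtain ⟨g, hg, -⟩ := hcol i hi
    exact ⟨g, hg⟩
  choose g hgS hg using fun i => Finset.exists_min_image S (fun v => (v.1 i : ℕ)) hSne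
  have hsum : k < ∑ i ∈ C, (((g i).1 i : ℕ) + 1) := by
    by_contra! hle
    obtain ⟨x, hx⟩ := SimplexGrid.exists_of_sum_le hCne hle
    obtain ⟨i, hi, hxi⟩ := hdom x
    have := hxi (g i) (hgS i)
    have := hx i hi
    omega
  rw [Finset.sum_add_distrib, Finset.sum_const, smul_eq_mul, mul_one] at hsum
  have hCcard : C.card ≤ Fintype.card I := Finset.card_le_univ C
  have hin : ∀ v ∈ S, ∀ i ∈ C, (v.1 i : ℕ) ≤ (g i).1 i + Fintype.card I := by
    intro v hv i hi
    have h1 : ∑ j ∈ C, (v.1 j : ℕ) ≤ k :=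
      (Finset.sum_le_univ_sum_of_nonneg fun _ => Nat.zero_le _).trans v.2.le
    have h2 : ∑ j ∈ C.erase i, ((g j).1 j : ℕ) ≤ ∑ j ∈ C.erase i, (v.1 j : ℕ) :=
      Finset.sum_le_sum fun j _ => hg j v hv
    have h3 := Finset.add_sum_erase C (fun j => (v.1 j : ℕ)) hi
    have h4 := Finset.add_sum_erase C (fun j => ((g j).1 j : ℕ)) hi
    omega
  have hout : ∀ v ∈ S, ∀ i ∉ C, (v.1 i : ℕ) ≤ Fintype.card I := by
    intro v hv i hi
    have h1 : ∑ j ∈ insert i C, (v.1 j : ℕ) ≤ k :=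
      (Finset.sum_le_univ_sum_of_nonneg fun _ => Nat.zero_le _).trans v.2.le
    have h2 : ∑ j ∈ C, ((g j).1 j : ℕ) ≤ ∑ j ∈ C, (v.1 j : ℕ) :=
      Finset.sum_le_sum fun j _ => hg j v hv
    rw [Finset.sum_insert hi] at h1
    omega
  refine ⟨S, C, hSne, hcol, fun u hu v hv i => ?_, hout⟩
  by_cases hi : i ∈ C
  · exact (hin u hu i hi).trans (Nat.add_le_add_right (hg i v hv) _)
  · exact (hout u hu i hi).trans (Nat.le_add_left _ _)

theorem exists_approx_le_of_mapsTo_stdSimplex [Nonempty I] {f : (I → ℝ) → I → ℝ}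
    (hf : Set.MapsTo f (stdSimplex ℝ I) (stdSimplex ℝ I)) {k : ℕ} (hk : 0 < k) :
    ∃ p ∈ stdSimplex ℝ I, ∀ i, ∃ q ∈ stdSimplex ℝ I,
      (∀ j, |q j - p j| ≤ Fintype.card I / k) ∧ p i ≤ f q i + Fintype.card I / k := by
  have hk' : (0 : ℝ) < k := by positivity
  have hlabel : ∀ v : SimplexGrid I k, ∃ i, v.toReal i ≤ f v.toReal i := by
    intro v
    obtain ⟨i, -, hi⟩ := Finset.exists_le_of_sum_le (s := Finset.univ)
      (f := v.toReal) (g := f v.toReal) Finset.univ_nonempty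
      (by rw [(v.toReal_mem hk).2, (hf (v.toReal_mem hk)).2])
    exact ⟨i, hi⟩
  choose c hc using hlabel
  obtain ⟨S, C, ⟨v, hv⟩, hcol, hclose, hout⟩ := exists_grid_cell c
  have hle : ∀ u ∈ S, ∀ w ∈ S, ∀ i, u.toReal i ≤ w.toReal i + Fintype.card I / k := by
    intro u hu w hw i
    simp only [SimplexGrid.toReal]
    rw [← add_div]
    gcongr
    exact_mod_cast hclose u hu w hw i
  refine ⟨v.toReal, v.toReal_mem hk, fun i => ?_⟩
  by_cases hi : i ∈ C
  · obtain ⟨g, hg, rfl⟩ := hcol i hi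
    refine ⟨g.toReal, g.toReal_mem hk, fun j => ?_, ?_⟩
    · rw [abs_le]
      constructor <;> linarith [hle g hg v hv j, hle v hv g hg j]
    · linarith [hle v hv g hg (c g), hc g]
  · refine ⟨v.toReal, v.toReal_mem hk, fun j => by simp; positivity, ?_⟩
    have h1 : v.toReal i ≤ Fintype.card I / k := by
      simp only [SimplexGrid.toReal]
      gcongr
      exact_mod_cast hout v hv i hi
    linarith [(hf (v.toReal_mem hk)).1 i]

/-- **Brouwer's fixed point theorem** for the standard simplex. -/
theorem exists_fixedPoint_stdSimplex [Nonempty I] {f : (I → ℝ) → I → ℝ}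
    (hf : Set.MapsTo f (stdSimplex ℝ I) (stdSimplex ℝ I))
    (hcont : ContinuousOn f (stdSimplex ℝ I)) : ∃ p ∈ stdSimplex ℝ I, f p = p := by
  classical
  have hcpt : IsCompact (stdSimplex ℝ I) := isCompact_stdSimplex ℝ I
  set Φ : (I → ℝ) → ℝ := fun p => ∑ i, max (p i - f p i) 0 with hΦ
  have hΦc : ContinuousOn Φ (stdSimplex ℝ I) := by
    refine continuousOn_finsetSum _ fun i _ => ContinuousOn.sup (ContinuousOn.sub ?_ ?_)
      continuousOn_const
    · exact (continuous_apply i).continuousOn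
    · exact (continuous_apply i).comp_continuousOn hcont
  obtain ⟨p, hp, hmin⟩ := hcpt.exists_isMinOn
    ⟨_, single_mem_stdSimplex ℝ (Classical.arbitrary I)⟩ hΦc
  have hn : (0 : ℝ) < Fintype.card I := by exact_mod_cast Fintype.card_pos
  have hle : Φ p ≤ 0 := by
    by_contra! hpos
    set ε : ℝ := Φ p / (4 * Fintype.card I) with hε
    have hε0 : 0 < ε := by positivity
    obtain ⟨δ, hδ, huc⟩ := Metric.uniformContinuousOn_iff.1
      (hcpt.uniformContinuousOn_of_continuous hcont) ε hε0
    obtain ⟨k, hk⟩ := exists_nat_gt (Fintype.card I / min δ ε)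
    have hmin0 : 0 < min δ ε := lt_min hδ hε0
    have hk0 : (0 : ℝ) < k := lt_of_le_of_lt (by positivity) hk
    have hkδ : Fintype.card I / (k : ℝ) < min δ ε := by
      rw [div_lt_iff₀ hmin0] at hk
      rw [div_lt_iff₀ hk0]; linarith
    obtain ⟨q, hq, hqi⟩ := exists_approx_le_of_mapsTo_stdSimplex hf (k := k)
      (by exact_mod_cast hk0)
    have hterm : ∀ i, max (q i - f q i) 0 ≤ 2 * ε := by
      intro i
      obtain ⟨s, hs, hsq, hi⟩ := hqi i
      have hd : dist s q < δ := (dist_pi_lt_iff hδ).2 fun j => by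
        rw [Real.dist_eq]
        exact (hsq j).trans_lt (hkδ.trans_le (min_le_left _ _))
      have h1 := (dist_le_pi_dist (f s) (f q) i).trans_lt (huc s hs q hq hd)
      rw [Real.dist_eq, abs_lt] at h1
      have := min_le_right δ ε
      refine max_le ?_ (by positivity)
      linarith
    have h1 : Φ q ≤ Fintype.card I * (2 * ε) := by
      refine (Finset.sum_le_sum fun i _ => hterm i).trans ?_
      rw [Finset.sum_const, Finset.card_univ, nsmul_eq_mul]
    have h2 : (Fintype.card I : ℝ) * (2 * ε) = Φ p / 2 := by
      rw [hε]; field_simp; norm_num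
    have h3 : Φ p ≤ Φ q := hmin hq
    linarith
  have hpi : ∀ i ∈ Finset.univ, p i ≤ f p i := by
    intro i _
    have h0 : Φ p = 0 := le_antisymm hle (Finset.sum_nonneg fun _ _ => le_max_right _ _)
    have := (Finset.sum_eq_zero_iff_of_nonneg fun _ _ => le_max_right _ _).1 h0 i
      (Finset.mem_univ i)
    have h1 := le_max_left (p i - f p i) 0
    linarith
  have := (Finset.sum_eq_sum_iff_of_le hpi).1 (by rw [hp.2, (hf hp).2])
  exact ⟨p, hp, (funext fun i => this i (Finset.mem_univ i)).symm⟩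

end Brouwer

section WeakTopology

variable {E : Type*} [NormedAddCommGroup E] [NormedSpace ℝ E]

namespace WeakConv

theorem comp {u : ℕ → E} {x : E} (h : WeakConv u x) {φ : ℕ → ℕ} (hφ : Tendsto φ atTop atTop) :
    WeakConv (fun n => u (φ n)) x := fun f => (h f).comp hφ

theorem of_tendsto {u : ℕ → E} {x : E} (h : Tendsto u atTop (𝓝 x)) : WeakConv u x := fun f =>
  (f.continuous.tendsto x).comp h

theorem add {u v : ℕ → E} {x y : E} (hu : WeakConv u x) (hv : WeakConv v y) :
    WeakConv (fun n => u n + v n) (x + y) := fun f => by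
  simpa using (hu f).add (hv f)

theorem unique {u : ℕ → E} {x y : E} (hx : WeakConv u x) (hy : WeakConv u y) : x = y :=
  (SeparatingDual.eq_iff_forall_dual_eq (R := ℝ)).2 fun f => tendsto_nhds_unique (hx f) (hy f)

theorem mem_of_isClosed_of_convex {u : ℕ → E} {x : E} (h : WeakConv u x) {K : Set E}
    (hK : IsClosed K) (hc : Convex ℝ K) (hu : ∀ n, u n ∈ K) : x ∈ K := by
  by_contra hx
  obtain ⟨f, c, hf, hfx⟩ := geometric_hahn_banach_closed_point hc hK hx
  exact absurd (le_of_tendsto' (h f) fun n => (hf _ (hu n)).le) (not_le.2 hfx)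

end WeakConv

/-- Countably many functionals separate the points of a norm-separable subspace. -/
theorem exists_seq_dual_separating {s : Set E} (hs : TopologicalSpace.IsSeparable s) :
    ∃ f : ℕ → E →L[ℝ] ℝ, ∀ z ∈ s, (∀ j, f j z = 0) → z = 0 := by
  obtain ⟨c, hc, hsc⟩ := hs
  rcases c.eq_empty_or_nonempty with rfl | hne
  · exact ⟨fun _ => 0, fun z hz => by simpa using hsc hz⟩
  obtain ⟨d, rfl⟩ := hc.exists_eq_range hne
  choose g hg hgx using fun x : E => exists_dual_vector'' ℝ x
  refine ⟨fun j => g (d j), fun z hz h0 => ?_⟩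
  by_contra hz0
  obtain ⟨_, ⟨j, rfl⟩, hj⟩ := Metric.mem_closure_iff.1 (hsc hz) (‖z‖ / 2) (by positivity)
  rw [dist_eq_norm] at hj
  have h1 : ‖d j‖ ≤ ‖z - d j‖ := by
    calc ‖d j‖ = |g (d j) (z - d j)| := by
          rw [map_sub, h0 j, hgx]; simp
      _ ≤ 1 * ‖z - d j‖ := (g (d j)).le_of_opNorm_le (hg _) _
      _ = ‖z - d j‖ := one_mul _
  have h2 : ‖z‖ ≤ ‖z - d j‖ + ‖d j‖ := by simpa using norm_add_le (z - d j) (d j)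
  linarith

theorem subset_weakClosure (s : Set E) : s ⊆ weakClosure s := fun _ hx =>
  subset_closure (s := toWeakSpace ℝ E '' s) (Set.mem_image_of_mem _ hx)

theorem continuous_weakSpace_apply (f : E →L[ℝ] ℝ) :
    Continuous fun w : WeakSpace ℝ E => f ((toWeakSpace ℝ E).symm w) :=
  WeakBilin.eval_continuous (topDualPairing ℝ E).flip f

/-- **Šmulian's theorem**: weakly compact sets are weakly sequentially compact. -/
theorem WeaklyCompact.exists_subseq {W : Set E} (hW : WeaklyCompact W) {u : ℕ → E}
    (hu : ∀ n, u n ∈ W) : ∃ w ∈ W, ∃ φ : ℕ → ℕ, StrictMono φ ∧ WeakConv (fun n => u (φ n)) w := by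
  let Z : Submodule ℝ E := (Submodule.span ℝ (Set.range u)).topologicalClosure
  have hZsep : TopologicalSpace.IsSeparable (Z : Set E) :=
    ((Set.countable_range u).isSeparable.span (R := ℝ)).closure
  have hZcl : IsClosed (toWeakSpace ℝ E '' (Z : Set E)) := by
    have h := Z.convex.toWeakSpace_closure ℝ
    rw [(Submodule.isClosed_topologicalClosure _).closure_eq] at h
    rw [h]
    exact isClosed_closure
  have huZ : ∀ n, u n ∈ Z := fun n =>
    Submodule.le_topologicalClosure _ (Submodule.subset_span ⟨n, rfl⟩)
  obtain ⟨f, hf⟩ := exists_seq_dual_separating hZsep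
  let K : Set (WeakSpace ℝ E) := toWeakSpace ℝ E '' W ∩ toWeakSpace ℝ E '' (Z : Set E)
  have hK : IsCompact K := IsCompact.inter_right hW hZcl
  have : CompactSpace K := isCompact_iff_compactSpace.1 hK
  let Λ : K → ℕ → ℝ := fun w j => f j ((toWeakSpace ℝ E).symm w.1)
  have hΛ : Continuous Λ := continuous_pi fun j =>
    (continuous_weakSpace_apply (f j)).comp continuous_subtype_val
  have hΛi : Function.Injective Λ := by
    rintro ⟨_, _, v, hv, rfl⟩ ⟨_, _, w, hw, rfl⟩ h
    have : v - w = 0 := hf _ (Z.sub_mem hv hw) fun j => by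
      have := congrFun h j
      simp only [Λ, LinearEquiv.symm_apply_apply] at this
      rw [map_sub, this, sub_self]
    simp [sub_eq_zero.1 this]
  have : TopologicalSpace.MetrizableSpace K :=
    (hΛ.isClosedEmbedding hΛi).isEmbedding.metrizableSpace
  obtain ⟨w, φ, hφ, hlim⟩ := CompactSpace.tendsto_subseq
    (fun n => (⟨toWeakSpace ℝ E (u n), ⟨u n, hu n, rfl⟩, ⟨u n, huZ n, rfl⟩⟩ : K))
  obtain ⟨_, ⟨w, hw, rfl⟩, _⟩ := w
  refine ⟨w, hw, φ, hφ, fun g => ?_⟩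
  have := (((continuous_weakSpace_apply g).comp continuous_subtype_val).tendsto _).comp hlim
  simpa [Function.comp_def] using this

/-- A Schauder-type approximation: up to `ε`, measured through `L`, the map `N` has a fixed
point. -/
theorem exists_mem_convexHull_near_image {F : Type*} [NormedAddCommGroup F] [NormedSpace ℝ F]
    (L : E →L[ℝ] F) {K : Set E} (hK : Convex ℝ K) (hne : K.Nonempty) {N : E → E}
    (hN : Set.MapsTo N K K) (hcont : ContinuousOn (fun x => L (N x)) K)
    (htb : TotallyBounded (L '' (N '' K))) {ε : ℝ} (hε : 0 < ε) :
    ∃ x ∈ K, x ∈ convexHull ℝ {w ∈ N '' K | ‖L w - L (N x)‖ < ε} := by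
  classical
  obtain ⟨t, htK, htfin, ht⟩ := Metric.finite_approx_of_totallyBounded htb ε hε
  have : Fintype t := htfin.fintype
  choose w hwK hwt using fun i : t => htK i.2
  have hcov : ∀ x ∈ K, ∃ i : t, ‖L (N x) - L (w i)‖ < ε := by
    intro x hx
    obtain ⟨y, hy, hxy⟩ := Set.mem_iUnion₂.1 (ht ⟨N x, ⟨x, hx, rfl⟩, rfl⟩)
    refine ⟨⟨y, hy⟩, ?_⟩
    rw [hwt, ← dist_eq_norm]
    exact hxy
  obtain ⟨x₀, hx₀⟩ := hne
  have : Nonempty t := ⟨(hcov x₀ hx₀).choose⟩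
  have hwK' : ∀ i, w i ∈ K := fun i => by
    obtain ⟨x, hx, hxw⟩ := hwK i
    exact hxw ▸ hN hx
  let P : (t → ℝ) → E := fun l => ∑ i, l i • w i
  have hPc : Continuous P := by fun_prop
  have hPK : Set.MapsTo P (stdSimplex ℝ t) K := fun l hl =>
    hK.sum_mem (fun i _ => hl.1 i) hl.2 fun i _ => hwK' i
  let ψ : E → t → ℝ := fun x i => max (ε - ‖L (N x) - L (w i)‖) 0
  have hψ0 : ∀ x i, 0 ≤ ψ x i := fun _ _ => le_max_right _ _
  have hψpos : ∀ x ∈ K, 0 < ∑ i, ψ x i := by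
    intro x hx
    obtain ⟨i, hi⟩ := hcov x hx
    exact Finset.sum_pos' (fun i _ => hψ0 x i)
      ⟨i, Finset.mem_univ _, lt_max_of_lt_left (sub_pos.2 hi)⟩
  have hψc : ∀ i, ContinuousOn (fun x => ψ x i) K := fun i =>
    ContinuousOn.sup (continuousOn_const.sub (hcont.sub continuousOn_const).norm)
      continuousOn_const
  obtain ⟨l, hl, hfix⟩ := exists_fixedPoint_stdSimplex
    (f := fun l i => ψ (P l) i / ∑ j, ψ (P l) j)
    (fun l hl => ⟨fun i => div_nonneg (hψ0 _ _) (hψpos _ (hPK hl)).le, by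
      rw [← Finset.sum_div, div_self (hψpos _ (hPK hl)).ne']⟩)
    (continuousOn_pi.2 fun i => ContinuousOn.div ((hψc i).comp hPc.continuousOn hPK)
      (continuousOn_finsetSum _ fun j _ => (hψc j).comp hPc.continuousOn hPK)
      fun l hl => (hψpos _ (hPK hl)).ne')
  refine ⟨P l, hPK hl, ?_⟩
  have hsupp : ∀ i, l i ≠ 0 → ‖L (w i) - L (N (P l))‖ < ε := by
    intro i hi
    by_contra! hle
    refine hi ?_
    rw [← hfix]
    have : ψ (P l) i = 0 := max_eq_right (by rw [norm_sub_rev] at hle; linarith)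
    simp [this]
  have hP : P l = ∑ i ∈ Finset.univ.filter (fun i => l i ≠ 0), l i • w i := by
    refine (Finset.sum_filter_of_ne fun i _ h => ?_).symm
    exact fun h0 => h (by rw [h0, zero_smul])
  rw [hP]
  refine (convex_convexHull ℝ _).sum_mem (fun i _ => hl.1 i) ?_ fun i hi => ?_
  · rw [Finset.sum_filter_ne_zero]
    exact hl.2
  · rw [← hP]
    exact subset_convexHull ℝ _ ⟨hwK i, hsupp i (Finset.mem_filter.1 hi).2⟩

/-- Fixed points of weakly sequentially continuous maps with relatively weakly compact range, on
norm-separable closed convex sets. -/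
theorem exists_fixedPoint_of_isSeparable {K W : Set E} (hcl : IsClosed K) (hconv : Convex ℝ K)
    (hne : K.Nonempty) (hsep : TopologicalSpace.IsSeparable K) (hW : WeaklyCompact W) {N : E → E}
    (hN : Set.MapsTo N K K) (hNW : Set.MapsTo N K W)
    (hwsc : ∀ (u : ℕ → E) (x : E), (∀ n, u n ∈ K) → x ∈ K → WeakConv u x →
      WeakConv (fun n => N (u n)) (N x)) : ∃ x ∈ K, N x = x := by
  let Z : Submodule ℝ E := (Submodule.span ℝ K).topologicalClosure
  obtain ⟨f, hf⟩ := exists_seq_dual_separating (s := (Z : Set E)) (hsep.span (R := ℝ)).closure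
  have hKZ : K ⊆ Z := fun x hx => Submodule.le_topologicalClosure _ (Submodule.subset_span hx)
  let L : (n : ℕ) → E →L[ℝ] (Fin n → ℝ) := fun n => ContinuousLinearMap.pi fun j => f j
  have hstep : ∀ n : ℕ, ∃ x ∈ K,
      x ∈ convexHull ℝ {w ∈ N '' K | ‖L n w - L n (N x)‖ < 1 / ((n : ℝ) + 1)} := by
    intro n
    refine exists_mem_convexHull_near_image (L n) hconv hne hN ?_ ?_ (by positivity)
    · rw [continuousOn_iff_continuous_domRestrict]
      refine SeqContinuous.continuous fun u x hux => tendsto_pi_nhds.2 fun j => ?_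
      exact hwsc (fun n => u n) x (fun n => (u n).2) x.2
        (WeakConv.of_tendsto ((continuous_subtype_val.tendsto x).comp hux)) (f j)
    · have hc : IsCompact (L n '' W) := by
        have h := IsCompact.image hW
          (continuous_pi fun j : Fin n => continuous_weakSpace_apply (f j))
        rw [Set.image_image] at h
        exact h
      refine hc.totallyBounded.subset (Set.image_mono ?_)
      rintro _ ⟨x, hx, rfl⟩
      exact hNW hx
  choose x hxK hxN using hstep
  have hunif : ∀ (g : E →L[ℝ] ℝ) (ε : ℝ), 0 < ε → ∃ n₀ : ℕ, ∀ n ≥ n₀, ∀ u ∈ N '' K, ∀ v ∈ N '' K,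
      ‖L n u - L n v‖ < 1 / ((n : ℝ) + 1) → |g u - g v| < ε := by
    intro g ε hε
    by_contra! hcon
    choose m hm u hu v hv huv hgap using hcon
    have hNKW : N '' K ⊆ W := Set.mapsTo_iff_image_subset.1 hNW
    have hNKZ : N '' K ⊆ Z := (Set.mapsTo_iff_image_subset.1 hN).trans hKZ
    obtain ⟨u', -, φ, hφ, hu'⟩ := hW.exists_subseq fun n => hNKW (hu n)
    obtain ⟨v', -, χ, hχ, hv'⟩ := hW.exists_subseq fun n => hNKW (hv (φ n))
    have hu'' := hu'.comp hχ.tendsto_atTop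
    have hZc : IsClosed (Z : Set E) := Submodule.isClosed_topologicalClosure _
    have hu'Z : u' ∈ Z := hu'.mem_of_isClosed_of_convex hZc Z.convex fun n => hNKZ (hu _)
    have hv'Z : v' ∈ Z := hv'.mem_of_isClosed_of_convex hZc Z.convex fun n => hNKZ (hv _)
    have hφχ : Tendsto (fun n => m (φ (χ n))) atTop atTop :=
      tendsto_atTop_mono (fun n => (hφ.comp hχ).le_apply.trans (hm _)) tendsto_id
    have heq : u' = v' := by
      refine sub_eq_zero.1 (hf _ (Z.sub_mem hu'Z hv'Z) fun j => ?_)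
      have h1 : Tendsto (fun n => f j (u (φ (χ n))) - f j (v (φ (χ n)))) atTop
          (𝓝 (f j u' - f j v')) := (hu'' (f j)).sub (hv' (f j))
      have h2 : Tendsto (fun n => f j (u (φ (χ n))) - f j (v (φ (χ n)))) atTop (𝓝 0) := by
        refine squeeze_zero_norm' ?_
          ((tendsto_one_div_add_atTop_nhds_zero_nat (𝕜 := ℝ)).comp hφχ)
        filter_upwards [hφχ.eventually_gt_atTop j] with n hn
        refine le_trans ?_ (huv (φ (χ n))).le
        exact norm_le_pi_norm (L (m (φ (χ n))) (u (φ (χ n))) - L (m (φ (χ n))) (v (φ (χ n))))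
          ⟨j, hn⟩
      rw [map_sub]
      exact tendsto_nhds_unique h1 h2
    have h3 : Tendsto (fun n => |g (u (φ (χ n))) - g (v (φ (χ n)))|) atTop
        (𝓝 |g u' - g v'|) := ((hu'' g).sub (hv' g)).abs
    have h4 := ge_of_tendsto' h3 fun n => hgap (φ (χ n))
    rw [heq, sub_self, abs_zero] at h4
    exact absurd hε (not_lt.2 h4)
  have hdiff : ∀ g : E →L[ℝ] ℝ, Tendsto (fun n => g (x n) - g (N (x n))) atTop (𝓝 0) := by
    intro g
    refine Metric.tendsto_atTop.2 fun ε hε => ?_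
    obtain ⟨n₀, hn₀⟩ := hunif g (ε / 2) (by positivity)
    refine ⟨n₀, fun n hn => ?_⟩
    have hsub : convexHull ℝ {w ∈ N '' K | ‖L n w - L n (N (x n))‖ < 1 / ((n : ℝ) + 1)} ⊆
        g ⁻¹' Metric.closedBall (g (N (x n))) (ε / 2) := by
      refine convexHull_min ?_ ((convex_closedBall _ _).is_linear_preimage g.toLinearMap.isLinear)
      rintro w ⟨hw, hwn⟩
      exact (hn₀ n hn w hw _ ⟨x n, hxK n, rfl⟩ hwn).le
    have := hsub (hxN n)
    rw [Set.mem_preimage, Metric.mem_closedBall, Real.dist_eq] at this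
    rw [Real.dist_eq, sub_zero]
    linarith
  obtain ⟨w, -, φ, hφ, hw⟩ := hW.exists_subseq fun n => hNW (hxK n)
  have hxw : WeakConv (fun n => x (φ n)) w := fun g => by
    simpa using ((hdiff g).comp hφ.tendsto_atTop).add (hw g)
  have hwK : w ∈ K := hxw.mem_of_isClosed_of_convex hcl hconv fun n => hxK _
  exact ⟨w, hwK, (hwsc _ w (fun n => hxK _) hwK hxw).unique hw⟩

theorem isSeparable_convexHull {s : Set E} (hs : TopologicalSpace.IsSeparable s) :
    TopologicalSpace.IsSeparable (convexHull ℝ s) :=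
  (hs.span (R := ℝ)).mono (convexHull_min Submodule.subset_span (Submodule.span ℝ s).convex)

/-- The image of a separable set under a weakly sequentially continuous map is separable. -/
theorem isSeparable_image_of_weakSeqContinuous {S s : Set E} (hs : TopologicalSpace.IsSeparable s)
    (hsS : s ⊆ S) {N : E → E}
    (hwsc : ∀ (u : ℕ → E) (x : E), (∀ n, u n ∈ S) → x ∈ S → WeakConv u x →
      WeakConv (fun n => N (u n)) (N x)) : TopologicalSpace.IsSeparable (N '' s) := by
  obtain ⟨t, hts, htc, hst⟩ := hs.exists_countable_dense_subset
  have hsep : TopologicalSpace.IsSeparable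
      ((Submodule.span ℝ (N '' t)).topologicalClosure : Set E) :=
    ((htc.image N).isSeparable.span (R := ℝ)).closure
  refine hsep.mono ?_
  rintro _ ⟨x, hx, rfl⟩
  obtain ⟨u, hu, hux⟩ := mem_closure_iff_seq_limit.1 (hst hx)
  have hlim := hwsc u x (fun n => hsS (hts (hu n))) (hsS hx) (WeakConv.of_tendsto hux)
  exact hlim.mem_of_isClosed_of_convex
    (Submodule.isClosed_topologicalClosure _) (Submodule.convex _) fun n =>
      Submodule.le_topologicalClosure _ (Submodule.subset_span ⟨u n, hu n, rfl⟩)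

/-- A weakly sequentially continuous self-map of a closed convex set leaves a separable closed
convex subset invariant. -/
theorem exists_separable_invariant {S : Set E} (hcl : IsClosed S) (hconv : Convex ℝ S)
    (hne : S.Nonempty) {N : E → E} (hN : Set.MapsTo N S S)
    (hwsc : ∀ (u : ℕ → E) (x : E), (∀ n, u n ∈ S) → x ∈ S → WeakConv u x →
      WeakConv (fun n => N (u n)) (N x)) :
    ∃ K ⊆ S, IsClosed K ∧ Convex ℝ K ∧ K.Nonempty ∧ TopologicalSpace.IsSeparable K ∧
      Set.MapsTo N K K := by
  obtain ⟨x₀, hx₀⟩ := hne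
  let D : ℕ → Set E := fun n => Nat.rec {x₀} (fun _ s => convexHull ℝ (s ∪ N '' s)) n
  have hD : ∀ n, D (n + 1) = convexHull ℝ (D n ∪ N '' D n) := fun _ => rfl
  have hDS : ∀ n, D n ⊆ S := by
    intro n
    induction n with
    | zero => exact Set.singleton_subset_iff.2 hx₀
    | succ n ih =>
      rw [hD]
      exact convexHull_min (Set.union_subset ih ((hN.mono_left ih).image_subset)) hconv
  have hDsep : ∀ n, TopologicalSpace.IsSeparable (D n) := by
    intro n
    induction n with
    | zero => exact (Set.countable_singleton x₀).isSeparable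
    | succ n ih =>
      rw [hD]
      exact isSeparable_convexHull
        (ih.union (isSeparable_image_of_weakSeqContinuous ih (hDS n) hwsc))
  have hDconv : ∀ n, Convex ℝ (D n) := by
    rintro (_ | n)
    · exact convex_singleton x₀
    · exact convex_convexHull ℝ _
  have hmono : Monotone D := monotone_nat_of_le_succ fun n =>
    Set.subset_union_left.trans (subset_convexHull ℝ _)
  have hKconv : Convex ℝ (closure (⋃ n, D n)) :=
    (hmono.directed_le.convex_iUnion hDconv).closure
  have hsub : closure (⋃ n, D n) ⊆ S := closure_minimal (Set.iUnion_subset hDS) hcl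
  refine ⟨closure (⋃ n, D n), hsub, isClosed_closure, hKconv,
    ⟨x₀, subset_closure (Set.mem_iUnion.2 ⟨0, rfl⟩)⟩,
    (TopologicalSpace.IsSeparable.iUnion hDsep).closure, fun x hx => ?_⟩
  obtain ⟨u, hu, hux⟩ := mem_closure_iff_seq_limit.1 hx
  refine (hwsc u x (fun n => hsub (subset_closure (hu n))) (hsub hx)
    (WeakConv.of_tendsto hux)).mem_of_isClosed_of_convex isClosed_closure hKconv fun n => ?_
  obtain ⟨m, hm⟩ := Set.mem_iUnion.1 (hu n)
  exact subset_closure (Set.mem_iUnion.2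
    ⟨m + 1, subset_convexHull ℝ _ (Set.subset_union_right ⟨u n, hm, rfl⟩)⟩)

/-- A Schauder-type fixed point theorem for weakly sequentially continuous maps. -/
theorem exists_fixedPoint_of_weakSeqContinuous {S W : Set E} (hcl : IsClosed S)
    (hconv : Convex ℝ S) (hne : S.Nonempty) (hW : WeaklyCompact W) {N : E → E}
    (hN : Set.MapsTo N S S) (hNW : Set.MapsTo N S W)
    (hwsc : ∀ (u : ℕ → E) (x : E), (∀ n, u n ∈ S) → x ∈ S → WeakConv u x →
      WeakConv (fun n => N (u n)) (N x)) : ∃ x ∈ S, N x = x := by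
  obtain ⟨K, hKS, hKcl, hKconv, hKne, hKsep, hNK⟩ :=
    exists_separable_invariant hcl hconv hne hN hwsc
  obtain ⟨x, hx, hfix⟩ := exists_fixedPoint_of_isSeparable hKcl hKconv hKne hKsep hW hNK
    (hNW.mono_left hKS) fun u x hu hx => hwsc u x (fun n => hKS (hu n)) (hKS hx)
  exact ⟨x, hKS hx, hfix⟩

end WeakTopology

/-- hybrid fixed point theorem for `x = A x · B x + C x` in a real Banach
algebra with identity satisfying condition (P), where the set of solutions
`x = A x · B y + C x` (for `y ∈ S`) is relatively weakly compact. -/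
theorem hybrid_fixedPoint_of_relWeaklyCompact_solutions {X : Type*} [NormedRing X]
    [NormedAlgebra ℝ X] [CompleteSpace X] (hP : CondP X)
    (S : Set X) (hne : S.Nonempty) (hcl : IsClosed S) (hconv : Convex ℝ S)
    (A B C : X → X)
    (hAwsc : ∀ (u : ℕ → X) (x : X), WeakConv u x → WeakConv (fun n => A (u n)) (A x))
    (hCwsc : ∀ (u : ℕ → X) (x : X), WeakConv u x → WeakConv (fun n => C (u n)) (C x))
    (hBwsc : ∀ (u : ℕ → X) (x : X), (∀ n, u n ∈ S) → x ∈ S →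
      WeakConv u x → WeakConv (fun n => B (u n)) (B x))
    (a c : ℝ) (ha0 : 0 ≤ a) (hc0 : 0 ≤ c)
    (hAlip : ∀ x y : X, ‖A x - A y‖ ≤ a * ‖x - y‖)
    (hClip : ∀ x y : X, ‖C x - C y‖ ≤ c * ‖x - y‖)
    (hAreg : ∀ x : X, IsUnit (A x))
    (hBbdd : Bornology.IsBounded (B '' S))
    (hclosure : ∀ x y : X, y ∈ S → x = A x * B y + C x → x ∈ S)
    (hsol : RelWeaklyCompact {x : X | ∃ y ∈ S, x = A x * B y + C x})
    (hcontr : sSup ((fun y => ‖B y‖) '' S) * a + c < 1) :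
    ∃ x ∈ S, x = A x * B x + C x := by
  have hbdd : BddAbove ((fun y => ‖B y‖) '' S) := by
    obtain ⟨M, hM⟩ := hBbdd.exists_norm_le
    refine ⟨M, ?_⟩
    rintro _ ⟨y, hy, rfl⟩
    exact hM _ ⟨y, hy, rfl⟩
  set β := sSup ((fun y => ‖B y‖) '' S)
  have hBβ : ∀ y ∈ S, ‖B y‖ ≤ β := fun y hy => le_csSup hbdd ⟨y, hy, rfl⟩
  have hβ0 : 0 ≤ β := by
    obtain ⟨y, hy⟩ := hne
    exact (norm_nonneg _).trans (hBβ y hy)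
  have hlip : ∀ y ∈ S, ∀ x x' : X,
      ‖(A x * B y + C x) - (A x' * B y + C x')‖ ≤ (β * a + c) * ‖x - x'‖ := by
    intro y hy x x'
    calc ‖(A x * B y + C x) - (A x' * B y + C x')‖
        = ‖(A x - A x') * B y + (C x - C x')‖ := by rw [sub_mul]; congr 1; abel
      _ ≤ ‖A x - A x'‖ * ‖B y‖ + ‖C x - C x'‖ :=
          (norm_add_le _ _).trans (add_le_add_left (norm_mul_le _ _) _)
      _ ≤ (a * ‖x - x'‖) * β + c * ‖x - x'‖ := by
          gcongr
          exacts [hAlip x x', hBβ y hy, hClip x x']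
      _ = (β * a + c) * ‖x - x'‖ := by ring
  have huniq : ∀ y ∈ S, ∀ x x' : X, x = A x * B y + C x → x' = A x' * B y + C x' → x = x' := by
    intro y hy x x' hx hx'
    have h := hlip y hy x x'
    rw [← hx, ← hx'] at h
    have h0 := norm_nonneg (x - x')
    exact sub_eq_zero.1 (norm_eq_zero.1 (le_antisymm (by nlinarith) h0))
  have hex : ∀ y, ∃ x, y ∈ S → x = A x * B y + C x := by
    intro y
    by_cases hy : y ∈ S
    · have hc : ContractingWith ⟨β * a + c, by positivity⟩ fun x => A x * B y + C x :=
        ⟨hcontr, LipschitzWith.of_dist_le_mul fun x x' => by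
          rw [dist_eq_norm, dist_eq_norm]
          exact hlip y hy x x'⟩
      exact ⟨_, fun _ => hc.fixedPoint_isFixedPt.symm⟩
    · exact ⟨0, fun h => absurd h hy⟩
  choose N hN using hex
  have hNS : Set.MapsTo N S S := fun y hy => hclosure (N y) y hy (hN y hy)
  have hNW : Set.MapsTo N S (weakClosure {x : X | ∃ y ∈ S, x = A x * B y + C x}) :=
    fun y hy => subset_weakClosure _ ⟨y, hy, hN y hy⟩
  have hwsc : ∀ (u : ℕ → X) (x : X), (∀ n, u n ∈ S) → x ∈ S → WeakConv u x →
      WeakConv (fun n => N (u n)) (N x) := by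
    intro u x hu hx hux f
    refine tendsto_of_subseq_tendsto fun ns hns => ?_
    obtain ⟨w, -, φ, hφ, hw⟩ := WeaklyCompact.exists_subseq hsol fun n => hNW (hu (ns n))
    have hux' : WeakConv (fun n => u (ns (φ n))) x := hux.comp (hns.comp hφ.tendsto_atTop)
    have hlim := (hP _ _ _ _ (hAwsc _ _ hw)
      (hBwsc _ _ (fun n => hu (ns (φ n))) hx hux')).add (hCwsc _ _ hw)
    have hlim' : WeakConv (fun n => N (u (ns (φ n)))) (A w * B x + C w) := by
      convert hlim using 2 with n
      exact hN _ (hu _)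
    have hwx : w = N x := huniq x hx _ _ (hw.unique hlim') (hN x hx)
    exact ⟨φ, by simpa [hwx] using hw f⟩
  obtain ⟨x, hx, hfix⟩ := exists_fixedPoint_of_weakSeqContinuous hcl hconv hne hsol hNS hNW hwsc
  exact ⟨x, hx, by simpa [hfix] using hN x hx⟩
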